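/- arXiv:1806.06382 — 5 statements merged into one kernel-verified Lean document; each statement's English description precedes it below -/
import Mathlib

section
/- Let λ : ℝ → ℝ be continuous with λ(t) = 0 for all t ≤ 0 and λ(t) > 0 for all t > 0, and let T > 0. If τ₀ ≥ 0, τ* ≥ 0, τ* ≠ τ₀ and min(τ₀, τ*) < T, then ∫₀ᵀ (λ(t − τ*) − λ(t − τ₀))² dt > 0. In particular the shifted intensities λ(· − τ*) and λ(· − τ₀) cannot coincide on [0, T]. -/
/-- two distinct shifts of an intensity shape `λ` (vanishing on `(-∞,0]`,
positive on `(0,∞)`) cannot coincide on `[0,T]`: the L² distance is positive. -/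
theorem stmt_2 (lam : ℝ → ℝ) (hc : Continuous lam)
    (h0 : ∀ t ≤ 0, lam t = 0) (hpos : ∀ t > 0, 0 < lam t)
    (T τ₀ τs : ℝ) (hT : 0 < T) (hτ₀ : 0 ≤ τ₀) (hτs : 0 ≤ τs)
    (hne : τs ≠ τ₀) (hmin : min τ₀ τs < T) :
    0 < ∫ t in (0:ℝ)..T, (lam (t - τs) - lam (t - τ₀)) ^ 2 := by
  refine intervalIntegral.integral_pos hT (by fun_prop) (fun t _ => sq_nonneg _)
    ⟨min T (max τ₀ τs), ⟨by positivity, min_le_left _ _⟩, ?_⟩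
  have hlt : min τ₀ τs < min T (max τ₀ τs) :=
    lt_min hmin (min_lt_max.mpr hne.symm)
  have hle : min T (max τ₀ τs) ≤ max τ₀ τs := min_le_right _ _
  generalize min T (max τ₀ τs) = t at hlt hle
  apply sq_pos_of_ne_zero
  rcases le_total τ₀ τs with h | h
  · rw [min_eq_left h] at hlt
    rw [max_eq_right h] at hle
    rw [h0 (t - τs) (by linarith), zero_sub, neg_ne_zero]
    exact (hpos (t - τ₀) (by linarith)).ne'
  · rw [min_eq_right h] at hlt
    rw [max_eq_left h] at hle
    rw [h0 (t - τ₀) (by linarith), sub_zero]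
    exact (hpos (t - τs) (by linarith)).ne'
end

section
/- Let λ : ℝ → ℝ be continuous with λ(t) = 0 for all t ≤ 0 and λ(t) > 0 for all t > 0, let 0 < α ≤ β < T, let τ₀ ∈ [α, β] and δ > 0. Then there exists a constant c > 0 such that for every τ ∈ [α, β] with |τ − τ₀| ≥ δ one has ∫₀ᵀ (λ(t − τ) − λ(t − τ₀))² dt ≥ c. (That is, the identifiability quantity g(δ) = inf_{|τ−τ₀|≥δ, τ∈[α,β]} ∫₀ᵀ (λ(t − τ) − λ(t − τ₀))² dt is strictly positive.) -/
theorem integral_sq_shift_sub_shift_pos {lam : ℝ → ℝ} (hc : Continuous lam)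
    (h0 : ∀ t ≤ 0, lam t = 0) (hpos : ∀ t > 0, 0 < lam t)
    {T σ τ : ℝ} (hσ : σ ∈ Set.Ioo 0 T) (hτ : τ ∈ Set.Ioo 0 T) (hne : σ ≠ τ) :
    0 < ∫ t in (0:ℝ)..T, (lam (t - σ) - lam (t - τ)) ^ 2 := by
  refine intervalIntegral.integral_pos (hσ.1.trans hσ.2) (by fun_prop)
    (fun t _ => sq_nonneg _) ?_
  -- At the later of the two arrival times exactly one of the shifted intensities vanishes.
  rcases lt_or_gt_of_ne hne with h | h
  · refine ⟨τ, ⟨hτ.1.le, hτ.2.le⟩, ?_⟩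
    have := hpos (τ - σ) (sub_pos.2 h)
    rw [h0 (τ - τ) (by simp), sub_zero]
    positivity
  · refine ⟨σ, ⟨hσ.1.le, hσ.2.le⟩, ?_⟩
    have := hpos (σ - τ) (sub_pos.2 h)
    rw [h0 (σ - σ) (by simp), zero_sub, neg_sq]
    positivity

/-- uniform identifiability of the arrival time: over the compact set
`{τ ∈ [α,β] : |τ − τ₀| ≥ δ}` the L² distance between shifted intensities is bounded
below by a positive constant. -/
theorem stmt_3 (lam : ℝ → ℝ) (hc : Continuous lam)
    (h0 : ∀ t ≤ 0, lam t = 0) (hpos : ∀ t > 0, 0 < lam t)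
    (T α β τ₀ δ : ℝ) (hα : 0 < α) (hαβ : α ≤ β) (hβT : β < T)
    (hτ₀ : τ₀ ∈ Set.Icc α β) (hδ : 0 < δ) :
    ∃ c > 0, ∀ τ ∈ Set.Icc α β, δ ≤ |τ - τ₀| →
      c ≤ ∫ t in (0:ℝ)..T, (lam (t - τ) - lam (t - τ₀)) ^ 2 := by
  have hcont : Continuous fun τ => ∫ t in (0:ℝ)..T, (lam (t - τ) - lam (t - τ₀)) ^ 2 :=
    intervalIntegral.continuous_parametric_intervalIntegral_of_continuous' (by fun_prop) 0 T
  have hK : IsCompact (Set.Icc α β ∩ {τ | δ ≤ |τ - τ₀|}) :=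
    isCompact_Icc.inter_right (isClosed_le continuous_const (by fun_prop))
  have hsub : Set.Icc α β ⊆ Set.Ioo 0 T := Set.Icc_subset_Ioo hα hβT
  rcases Set.eq_empty_or_nonempty (Set.Icc α β ∩ {τ | δ ≤ |τ - τ₀|}) with he | hne
  · refine ⟨1, one_pos, fun τ hτ hd => ?_⟩
    exact absurd ⟨hτ, hd⟩ (Set.eq_empty_iff_forall_notMem.1 he τ)
  · obtain ⟨σ, ⟨hσ, hσd⟩, hmin⟩ := hK.exists_isMinOn hne hcont.continuousOn
    refine ⟨_, integral_sq_shift_sub_shift_pos hc h0 hpos (hsub hσ) (hsub hτ₀) ?_,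
      fun τ hτ hd => hmin ⟨hτ, hd⟩⟩
    exact sub_ne_zero.1 (abs_pos.1 (hδ.trans_le hσd))
end

section
/- Let Θ ⊂ ℝ² be a compact set, let p₁, …, p_k ∈ ℝ² be detector positions among which some three are not collinear, let ν > 0, T > 0, and set τ_j(θ) = ν⁻¹‖p_j − θ‖. Assume 0 < τ_j(θ) < T for all θ ∈ Θ and j = 1, …, k, and let each λ_j : ℝ → ℝ be continuous with λ_j(t) = 0 for t ≤ 0 and λ_j(t) > 0 for t > 0. Then for every δ > 0 there exists a constant c > 0 such that for all θ, θ₀ ∈ Θ with ‖θ − θ₀‖ ≥ δ one has Σ_{j=1}^{k} ∫₀ᵀ (λ_j(t − τ_j(θ)) − λ_j(t − τ_j(θ₀)))² dt ≥ c. -/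
/-- In a Euclidean plane, points equidistant from two distinct points are collinear. -/
theorem collinear_of_forall_dist_eq {V : Type*} [NormedAddCommGroup V] [InnerProductSpace ℝ V]
    [Fact (Module.finrank ℝ V = 1 + 1)] {a b : V} (hab : a ≠ b) {s : Set V}
    (hs : ∀ x ∈ s, dist x a = dist x b) : Collinear ℝ s := by
  have : FiniteDimensional ℝ V := FiniteDimensional.of_fact_finrank_eq_succ 1
  have hsub : s ⊆ AffineSubspace.perpBisector a b := fun x hx =>
    AffineSubspace.mem_perpBisector_iff_dist_eq.2 (hs x hx)
  have hle : vectorSpan ℝ s ≤ (ℝ ∙ (b - a))ᗮ := by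
    have h := AffineSubspace.direction_le (affineSpan_le.2 hsub)
    rwa [direction_affineSpan, AffineSubspace.direction_perpBisector, vsub_eq_sub] at h
  rw [collinear_iff_finrank_le_one]
  exact (Submodule.finrank_mono hle).trans
    (Submodule.finrank_orthogonal_span_singleton (sub_ne_zero.2 hab.symm)).le

/-- Two distinct delays, both in `(0, T)`, of a signal that starts at time `0` are at positive
`L²` distance on `[0, T]`. -/
theorem integral_sq_sub_shift_pos {f : ℝ → ℝ} (hf : Continuous f) (h0 : ∀ t ≤ 0, f t = 0)
    (hpos : ∀ t > 0, 0 < f t) {T a b : ℝ} (ha : 0 < a) (haT : a < T) (hb : 0 < b) (hbT : b < T)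
    (hab : a ≠ b) : 0 < ∫ t in (0:ℝ)..T, (f (t - a) - f (t - b)) ^ 2 := by
  refine intervalIntegral.integral_pos (ha.trans haT) (by fun_prop) (fun t _ => sq_nonneg _) ?_
  rcases hab.lt_or_gt with h | h
  · refine ⟨b, ⟨hb.le, hbT.le⟩, ?_⟩
    have := hpos (b - a) (sub_pos.2 h)
    rw [sub_self, h0 0 le_rfl]
    positivity
  · refine ⟨a, ⟨ha.le, haT.le⟩, ?_⟩
    have := hpos (a - b) (sub_pos.2 h)
    rw [sub_self, h0 0 le_rfl, zero_sub, neg_sq]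
    positivity

/-- uniform identifiability of the source position: if some three detectors
are not collinear, then for every `δ > 0` the sum of the L² distances between the shifted
intensities is bounded below by a positive constant over pairs `θ, θ₀ ∈ Θ` with
`‖θ − θ₀‖ ≥ δ`. -/
theorem stmt_4 {k : ℕ} (Θ : Set (EuclideanSpace ℝ (Fin 2))) (hΘ : IsCompact Θ)
    (p : Fin k → EuclideanSpace ℝ (Fin 2))
    (hncol : ∃ j₁ j₂ j₃ : Fin k,
      ¬ Collinear ℝ ({p j₁, p j₂, p j₃} : Set (EuclideanSpace ℝ (Fin 2))))
    (ν T : ℝ) (hν : 0 < ν) (hT : 0 < T)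
    (hτ : ∀ θ ∈ Θ, ∀ j, 0 < ν⁻¹ * ‖p j - θ‖ ∧ ν⁻¹ * ‖p j - θ‖ < T)
    (lam : Fin k → ℝ → ℝ) (hc : ∀ j, Continuous (lam j))
    (h0 : ∀ j, ∀ t ≤ 0, lam j t = 0) (hpos : ∀ j, ∀ t > 0, 0 < lam j t)
    (δ : ℝ) (hδ : 0 < δ) :
    ∃ c > 0, ∀ θ ∈ Θ, ∀ θ₀ ∈ Θ, δ ≤ ‖θ - θ₀‖ →
      c ≤ ∑ j, ∫ t in (0:ℝ)..T,
          (lam j (t - ν⁻¹ * ‖p j - θ‖) - lam j (t - ν⁻¹ * ‖p j - θ₀‖)) ^ 2 := by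
  set F : EuclideanSpace ℝ (Fin 2) × EuclideanSpace ℝ (Fin 2) → ℝ := fun x =>
    ∑ j, ∫ t in (0:ℝ)..T,
      (lam j (t - ν⁻¹ * ‖p j - x.1‖) - lam j (t - ν⁻¹ * ‖p j - x.2‖)) ^ 2
  have hFc : Continuous F := by
    refine continuous_finsetSum _ fun j _ => ?_
    have := hc j
    exact intervalIntegral.continuous_parametric_intervalIntegral_of_continuous'
      (by fun_prop) 0 T
  set K : Set (EuclideanSpace ℝ (Fin 2) × EuclideanSpace ℝ (Fin 2)) :=
    Θ ×ˢ Θ ∩ {x | δ ≤ ‖x.1 - x.2‖}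
  have hKc : IsCompact K :=
    (hΘ.prod hΘ).inter_right (isClosed_le (by fun_prop) (by fun_prop))
  have hFpos : ∀ x ∈ K, 0 < F x := by
    rintro ⟨θ, θ₀⟩ ⟨⟨hθ, hθ₀⟩, hd⟩
    have hne : θ ≠ θ₀ := by
      rintro rfl
      simp only [Set.mem_ofPred_eq, sub_self, norm_zero] at hd
      exact hd.not_gt hδ
    obtain ⟨j, hj⟩ : ∃ j, ‖p j - θ‖ ≠ ‖p j - θ₀‖ := by
      by_contra! h
      obtain ⟨j₁, j₂, j₃, hn⟩ := hncol
      have : Fact (Module.finrank ℝ (EuclideanSpace ℝ (Fin 2)) = 1 + 1) := ⟨by simp⟩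
      refine hn (collinear_of_forall_dist_eq hne ?_)
      simp [dist_eq_norm, h]
    refine Finset.sum_pos' (fun i _ => intervalIntegral.integral_nonneg hT.le
      fun t _ => sq_nonneg _) ⟨j, Finset.mem_univ j, ?_⟩
    exact integral_sq_sub_shift_pos (hc j) (h0 j) (hpos j) (hτ θ hθ j).1 (hτ θ hθ j).2
      (hτ θ₀ hθ₀ j).1 (hτ θ₀ hθ₀ j).2 fun h => hj (mul_left_cancel₀ (inv_ne_zero hν.ne') h)
  obtain ⟨c, hc0, hcF⟩ := hKc.exists_forall_le' hFc.continuousOn hFpos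
  exact ⟨c, hc0, fun θ hθ θ₀ hθ₀ hd => hcF (θ, θ₀) ⟨⟨hθ, hθ₀⟩, hd⟩⟩
end

section
/- Let a > 0, λ₀ > 0 and 0 < τ < T. Then the function t ↦ a² / (4 (t − τ)(a√(t − τ) + λ₀)) is not Lebesgue-integrable on the interval (τ, T); that is, the Fisher information I_τ = ∫_τ^T (∂λ(t−τ)/∂τ)² · λ(t−τ)⁻¹ dt for the intensity λ(s) = a·√s·1_{s ≥ 0} + λ₀ is infinite. -/
/-- in the boundary case `κ = 1/2` the Fisher information is infinite:
the function `t ↦ a²/(4(t − τ)(a√(t − τ) + λ₀))` is not Lebesgue-integrable on `(τ, T)`. -/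
theorem stmt_12 (a lam₀ τ T : ℝ) (ha : 0 < a) (hlam₀ : 0 < lam₀)
    (hτ : 0 < τ) (hτT : τ < T) :
    ¬ MeasureTheory.IntegrableOn
        (fun t => a ^ 2 / (4 * (t - τ) * (a * Real.sqrt (t - τ) + lam₀)))
        (Set.Ioo τ T) MeasureTheory.volume := by
  rw [← intervalIntegrable_iff_integrableOn_Ioo_of_le hτT.le]
  refine not_intervalIntegrable_of_sub_inv_isBigO_punctured ?_ hτT.ne Set.left_mem_uIcc
  have hcont : Continuous fun t => 4 * (a * Real.sqrt (t - τ) + lam₀) / a ^ 2 := by fun_prop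
  have hbdd := (hcont.continuousAt (x := τ)).tendsto.isBigO_one ℝ |>.mono
    (nhdsWithin_le_nhds (s := {τ}ᶜ))
  refine (hbdd.mul (Asymptotics.isBigO_refl
    (fun t => a ^ 2 / (4 * (t - τ) * (a * Real.sqrt (t - τ) + lam₀))) _)).congr' ?_ (by simp)
  filter_upwards [self_mem_nhdsWithin] with t ht
  have hsub : t - τ ≠ 0 := sub_ne_zero.2 ht
  have hpos : a * Real.sqrt (t - τ) + lam₀ ≠ 0 := by positivity
  field_simp
end

section
/- Let p_j = (x_j, y_j) ∈ ℝ² for j = 1, …, k be detector positions, r_j² = x_j² + y_j², ν > 0, and let θ₀ = (x₀, y₀) ∈ ℝ² be the source position with travel times τ_j = ν⁻¹‖p_j − θ₀‖ and z_j = ν²τ_j². Define the 3×3 matrix A with rows (−2Σ_j x_j, −2Σ_j y_j, k), (−2Σ_j x_j², −2Σ_j x_j y_j, Σ_j x_j), (−2Σ_j x_j y_j, −2Σ_j y_j², Σ_j y_j), and the vector Z = (Σ_j (z_j − r_j²), Σ_j x_j(z_j − r_j²), Σ_j y_j(z_j − r_j²))ᵀ. Then the vector γ₀ = (x₀, y₀,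 x₀² + y₀²)ᵀ satisfies A γ₀ = Z; consequently, if A is invertible then γ₀ = A⁻¹ Z, i.e., the least-squares construction recovers the source position exactly from the exact travel times. -/
/-- the exact travel times solve the least-squares normal equations:
with `z_j = ν²τ_j²`, the vector `γ₀ = (x₀, y₀, x₀² + y₀²)` satisfies `A γ₀ = Z`, and if
`A` is invertible then `γ₀ = A⁻¹ Z`. -/
theorem stmt_14 {k : ℕ} (x y : Fin k → ℝ) (ν x₀ y₀ : ℝ) (hν : 0 < ν)
    (τ : Fin k → ℝ)
    (hτ : ∀ j, τ j = ν⁻¹ * Real.sqrt ((x j - x₀) ^ 2 + (y j - y₀) ^ 2))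
    (z : Fin k → ℝ) (hz : ∀ j, z j = ν ^ 2 * (τ j) ^ 2)
    (r2 : Fin k → ℝ) (hr2 : ∀ j, r2 j = (x j) ^ 2 + (y j) ^ 2)
    (A : Matrix (Fin 3) (Fin 3) ℝ)
    (hA : A = Matrix.of
      ![![(-2) * (∑ j, x j), (-2) * (∑ j, y j), (k : ℝ)],
        ![(-2) * (∑ j, (x j) ^ 2), (-2) * (∑ j, x j * y j), (∑ j, x j)],
        ![(-2) * (∑ j, x j * y j), (-2) * (∑ j, (y j) ^ 2), (∑ j, y j)]])
    (Z : Fin 3 → ℝ)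
    (hZ : Z = ![(∑ j, (z j - r2 j)), (∑ j, x j * (z j - r2 j)),
      (∑ j, y j * (z j - r2 j))]) :
    A.mulVec ![x₀, y₀, x₀ ^ 2 + y₀ ^ 2] = Z ∧
      (IsUnit A.det → ![x₀, y₀, x₀ ^ 2 + y₀ ^ 2] = A⁻¹.mulVec Z) := by
  have hzr : ∀ j, z j - r2 j = -2 * x j * x₀ + -2 * y j * y₀ + (x₀ ^ 2 + y₀ ^ 2) := by
    intro j
    rw [hz, hτ, hr2, mul_pow, Real.sq_sqrt (by positivity)]
    field_simp
    ring
  have hAZ : A.mulVec ![x₀, y₀, x₀ ^ 2 + y₀ ^ 2] = Z := by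
    have hk : (k : ℝ) = ∑ _j : Fin k, (1 : ℝ) := by simp
    subst hA hZ
    ext i
    fin_cases i <;>
      simp only [Matrix.mulVec, dotProduct, Fin.sum_univ_three, Matrix.of_apply, hzr, hk] <;>
      simp only [Fin.zero_eta, Fin.mk_one, Fin.reduceFinMk, Matrix.cons_val, Finset.mul_sum,
        Finset.sum_mul, ← Finset.sum_add_distrib] <;>
      exact Finset.sum_congr rfl fun j _ => by ring
  refine ⟨hAZ, fun hdet => ?_⟩
  rw [← hAZ, Matrix.mulVec_mulVec, Matrix.nonsing_inv_mul A hdet, Matrix.one_mulVec]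
end
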